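/- Let M be a 3-quasi-Sasakian manifold of rank 4l+3. Then the integrable distribution E^{4m} defines a Riemannian foliation of dimension 4m whose leaves, with the induced structures (φ_α, g restricted), are hyper-Kähler manifolds; moreover the 1-forms η_α, the 2-forms dη_α, the Reeb vector fields ξ_α, the tensors φ_α and the metric g are all projectable with respect to this foliation, and the (local) leaf space carries an induced 3-α-Sasakian structure. -/

import Mathlib

/-!
An abstract (Lie–Rinehart style) algebraic model of the differential geometry of
almost contact metric 3-structures: `F` plays the role of the algebra of smooth
functions on a manifold `M` of dimension `4n+3`, and `V` plays the role of the
`F`-module of smooth vector fields, acting on `F` by derivations and carrying a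
Lie bracket, a Riemannian metric `g`, and three almost contact metric structures
`(φ_α, ξ_α, η_α, g)`.
-/

noncomputable section

namespace QS3

/-- Cyclic (= even) permutations of `{0,1,2}`, modelling even permutations of `{1,2,3}`. -/
def Cyclic (a b c : Fin 3) : Prop :=
  (a, b, c) = (0, 1, 2) ∨ (a, b, c) = (1, 2, 0) ∨ (a, b, c) = (2, 0, 1)

/-- The algebraic model of the smooth structure of a manifold: an `ℝ`-algebra `F`
of smooth functions and an `F`-module `V` of vector fields acting on `F` by
derivations and carrying the Lie bracket of vector fields. -/
class SmoothSetting (F : Type) (V : Type) [CommRing F] [Algebra ℝ F]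
    [AddCommGroup V] [Module F V] where
  act : V → F → F
  bracket : V → V → V
  act_add : ∀ (X : V) (f₁ f₂ : F), act X (f₁ + f₂) = act X f₁ + act X f₂
  act_mul : ∀ (X : V) (f₁ f₂ : F), act X (f₁ * f₂) = act X f₁ * f₂ + f₁ * act X f₂
  act_const : ∀ (X : V) (r : ℝ), act X (algebraMap ℝ F r) = 0
  act_addLeft : ∀ (X Y : V) (f : F), act (X + Y) f = act X f + act Y f
  act_smulLeft : ∀ (f : F) (X : V) (h : F), act (f • X) h = f * act X h
  bracket_antisymm : ∀ X Y : V, bracket X Y = -bracket Y X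
  bracket_addLeft : ∀ X Y Z : V, bracket (X + Y) Z = bracket X Z + bracket Y Z
  bracket_act : ∀ (X Y : V) (f : F),
    act (bracket X Y) f = act X (act Y f) - act Y (act X f)
  bracket_smulRight : ∀ (X : V) (f : F) (Y : V),
    bracket X (f • Y) = f • bracket X Y + act X f • Y
  jacobi : ∀ X Y Z : V,
    bracket X (bracket Y Z) + bracket Y (bracket Z X) + bracket Z (bracket X Y) = 0

section d

variable (F V : Type) [CommRing F] [Algebra ℝ F] [AddCommGroup V] [Module F V]
  [SmoothSetting F V]

/-- The action of a vector field on a function (directional derivative). -/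
def der (X : V) (f : F) : F := SmoothSetting.act X f

/-- The Lie bracket of vector fields. -/
def lie (X Y : V) : V := SmoothSetting.bracket F X Y

/-- Exterior differential of a 1-form (with the `1/2` normalization convention,
so that `2 dθ(X,Y) = X θ(Y) - Y θ(X) - θ([X,Y])`). -/
def dOne (θ : V → F) (X Y : V) : F :=
  (2 : ℝ)⁻¹ • (der F V X (θ Y) - der F V Y (θ X) - θ (lie F V X Y))

/-- Exterior differential of a 2-form (with the `1/3` normalization convention). -/
def dTwo (ω : V → V → F) (X Y Z : V) : F :=
  (3 : ℝ)⁻¹ • (der F V X (ω Y Z) + der F V Y (ω Z X) + der F V Z (ω X Y)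
    - ω (lie F V X Y) Z - ω (lie F V Y Z) X - ω (lie F V Z X) Y)

end d

/-- An almost contact metric 3-structure on a manifold of dimension `4n+3`:
three almost contact metric structures `(φ_α, ξ_α, η_α, g)` satisfying the
quaternionic-type relations, together with a (local) orthonormal frame. -/
class ACM3 (F V : Type) [CommRing F] [Algebra ℝ F] [AddCommGroup V] [Module F V]
    [SmoothSetting F V] where
  n : ℕ
  g : V → V → F
  phi : Fin 3 → V → V
  xi : Fin 3 → V
  eta : Fin 3 → V → F
  g_symm : ∀ X Y, g X Y = g Y X
  g_addLeft : ∀ X Y Z, g (X + Y) Z = g X Z + g Y Z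
  g_smulLeft : ∀ (f : F) (X Y : V), g (f • X) Y = f * g X Y
  g_nondeg : ∀ X, (∀ Y, g X Y = 0) → X = 0
  phi_add : ∀ α (X Y : V), phi α (X + Y) = phi α X + phi α Y
  phi_smul : ∀ α (f : F) (X : V), phi α (f • X) = f • phi α X
  eta_eq : ∀ α X, eta α X = g X (xi α)
  acm_sq : ∀ α X, phi α (phi α X) = -X + eta α X • xi α
  eta_xi : ∀ α, eta α (xi α) = 1
  compat : ∀ α X Y, g (phi α X) (phi α Y) = g X Y - eta α X * eta α Y
  quat_phi : ∀ a b c, Cyclic a b c → ∀ X, phi c X = phi a (phi b X) - eta b X • xi a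
  quat_phi' : ∀ a b c, Cyclic a b c → ∀ X, phi c X = -(phi b (phi a X)) + eta a X • xi b
  quat_xi : ∀ a b c, Cyclic a b c → xi c = phi a (xi b)
  quat_xi' : ∀ a b c, Cyclic a b c → xi c = -(phi b (xi a))
  quat_eta : ∀ a b c, Cyclic a b c → ∀ X, eta c X = eta a (phi b X)
  quat_eta' : ∀ a b c, Cyclic a b c → ∀ X, eta c X = -(eta b (phi a X))
  frame : Fin (4 * n + 3) → V
  frame_orth : ∀ i j, g (frame i) (frame j) = if i = j then 1 else 0
  frame_span : ∀ X : V, X = ∑ i, g X (frame i) • frame i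

section acm

variable (F V : Type) [CommRing F] [Algebra ℝ F] [AddCommGroup V] [Module F V]
  [SmoothSetting F V] [ACM3 F V]

/-- The integer `n` (the manifold has dimension `4n+3`). -/
def dimn : ℕ := ACM3.n F V

/-- The Riemannian metric. -/
def gm (X Y : V) : F := ACM3.g X Y

/-- The structure tensors `φ_α`. -/
def ph (α : Fin 3) (X : V) : V := ACM3.phi F α X

/-- The Reeb vector fields `ξ_α`. -/
def rxi (α : Fin 3) : V := ACM3.xi F α

/-- The 1-forms `η_α`. -/
def et (α : Fin 3) (X : V) : F := ACM3.eta α X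

/-- The orthonormal frame. -/
def fr (i : Fin (4 * dimn F V + 3)) : V := ACM3.frame i

/-- The fundamental 2-form `Φ_α(X,Y) = g(X, φ_α Y)`. -/
def Phi (α : Fin 3) (X Y : V) : F := gm F V X (ph F V α Y)

/-- The Nijenhuis torsion `[φ_α, φ_α]` of `φ_α`. -/
def Nij (α : Fin 3) (X Y : V) : V :=
  ph F V α (ph F V α (lie F V X Y)) + lie F V (ph F V α X) (ph F V α Y)
    - ph F V α (lie F V (ph F V α X) Y) - ph F V α (lie F V X (ph F V α Y))

/-- The normality tensor `N⁽¹⁾_α = [φ_α, φ_α] + 2 dη_α ⊗ ξ_α`. -/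
def NOne (α : Fin 3) (X Y : V) : V :=
  Nij F V α X Y + ((2 : ℝ) • dOne F V (et F V α) X Y) • rxi F V α

/-- The structure `(φ_α, ξ_α, η_α)` is normal. -/
def IsNormal (α : Fin 3) : Prop := ∀ X Y, NOne F V α X Y = 0

/-- A 2-form is closed. -/
def IsClosedTwo (ω : V → V → F) : Prop := ∀ X Y Z, dTwo F V ω X Y Z = 0

/-- The structure `(φ_α, ξ_α, η_α, g)` is quasi-Sasakian: normal with closed
fundamental 2-form. -/
def IsQuasiSasakian (α : Fin 3) : Prop :=
  IsNormal F V α ∧ IsClosedTwo F V (Phi F V α)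

/-- `M` is 3-cosymplectic: each structure is normal with `dη_α = 0` and `dΦ_α = 0`. -/
def ThreeCosymplectic : Prop :=
  ∀ α, IsNormal F V α ∧ (∀ X Y, dOne F V (et F V α) X Y = 0) ∧
    IsClosedTwo F V (Phi F V α)

/-- `M` is 3-α-Sasakian with constant `a ≠ 0`: each structure is normal (an
`α`-Sasakian structure) and `dη_δ = a Φ_δ`. -/
def Is3AlphaSasakianWith (a : ℝ) : Prop :=
  a ≠ 0 ∧ (∀ δ, IsNormal F V δ) ∧
    ∀ (δ : Fin 3) (X Y : V), dOne F V (et F V δ) X Y = algebraMap ℝ F a * Phi F V δ X Y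

/-- A vector field is horizontal: it lies in `H = ∩_α ker η_α`. -/
def Horiz (X : V) : Prop := ∀ α, et F V α X = 0

/-- A vector field is vertical: it lies in `V = ⟨ξ₁, ξ₂, ξ₃⟩`. -/
def InVert (X : V) : Prop :=
  ∃ p q r : F, X = p • rxi F V 0 + q • rxi F V 1 + r • rxi F V 2

/-- The distribution `E^{4m} = {X ∈ H : i_X dη_α = 0}`. -/
def InE4m (X : V) : Prop :=
  Horiz F V X ∧ ∀ (α : Fin 3) (Y : V), dOne F V (et F V α) X Y = 0

/-- The distribution `E^{4l}`: the orthogonal complement of `E^{4m}` in `H`. -/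
def InE4l (X : V) : Prop :=
  Horiz F V X ∧ ∀ Y, InE4m F V Y → gm F V X Y = 0

/-- The distribution `E^{4l+3} = E^{4l} ⊕ V`. -/
def InE4l3 (X : V) : Prop :=
  ∃ Y Z, InE4l F V Y ∧ InVert F V Z ∧ X = Y + Z

/-- The distribution `E^{4m+3} = E^{4m} ⊕ V`. -/
def InE4m3 (X : V) : Prop :=
  ∃ Y Z, InE4m F V Y ∧ InVert F V Z ∧ X = Y + Z

/-- The horizontal component `X_H = X - ∑_α η_α(X) ξ_α` of a vector field. -/
def horComp (X : V) : V := X - ∑ α : Fin 3, et F V α X • rxi F V α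

/-- A vector field is basic with respect to the foliation defined by `E^{4m}`. -/
def BasicE4m (X : V) : Prop :=
  InE4l3 F V X ∧ ∀ W, InE4m F V W → InE4m F V (lie F V W X)

/-- A vector field is basic with respect to the foliation defined by `E^{4l+3}`. -/
def BasicE4l3 (X : V) : Prop :=
  InE4m F V X ∧ ∀ W, InE4l3 F V W → InE4l3 F V (lie F V W X)

end acm

/-- A 3-quasi-Sasakian structure: each of the three almost contact metric
structures is quasi-Sasakian.  We also record, as part of the structure, the
standard structural facts established for such manifolds in the literature
(Cappelletti Montano–De Nicola–Dileo): the Reeb commutation relations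
`[ξ_α, ξ_β] = c ξ_γ`, the splitting `H = E^{4l} ⊕ E^{4m}` (constancy of the
rank), the `φ_α`-invariance of both distributions, and the tensors `ψ_α`
(equal to `φ_α` on `E^{4l+3}` and vanishing on `E^{4m}` when the rank is
`4l+3`, i.e. `c ≠ 0`; equal to `φ_α` on `E^{4l}` and vanishing on `E^{4m+3}`
when the rank is `4l+1`, i.e. `c = 0`). -/
class ThreeQS (F V : Type) [CommRing F] [Algebra ℝ F] [AddCommGroup V] [Module F V]
    [SmoothSetting F V] [ACM3 F V] where
  qs : ∀ α, IsQuasiSasakian F V α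
  c : ℝ
  reeb_bracket : ∀ a b c', Cyclic a b c' →
    lie F V (rxi F V a) (rxi F V b) = algebraMap ℝ F c • rxi F V c'
  horiz_split : ∀ X, Horiz F V X → ∃ Y Z, InE4l F V Y ∧ InE4m F V Z ∧ X = Y + Z
  phi_E4l : ∀ α X, InE4l F V X → InE4l F V (ph F V α X)
  phi_E4m : ∀ α X, InE4m F V X → InE4m F V (ph F V α X)
  psi : Fin 3 → V → V
  psi_add : ∀ α (X Y : V), psi α (X + Y) = psi α X + psi α Y
  psi_smul : ∀ α (f : F) (X : V), psi α (f • X) = f • psi α X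
  psi_E4l : ∀ α X, InE4l F V X → psi α X = ph F V α X
  psi_E4m : ∀ α X, InE4m F V X → psi α X = 0
  psi_vert_of_ne : c ≠ 0 → ∀ α β, psi α (rxi F V β) = ph F V α (rxi F V β)
  psi_vert_of_eq : c = 0 → ∀ α β, psi α (rxi F V β) = 0

section tqs

variable (F V : Type) [CommRing F] [Algebra ℝ F] [AddCommGroup V] [Module F V]
  [SmoothSetting F V] [ACM3 F V] [ThreeQS F V]

/-- The constant `c` with `[ξ_α, ξ_β] = c ξ_γ`. -/
def cc : ℝ := ThreeQS.c F V

/-- The tensors `ψ_α`. -/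
def psiT (α : Fin 3) (X : V) : V := ThreeQS.psi F α X

/-- The tensors `θ_α = φ_α - ψ_α`. -/
def thetaT (α : Fin 3) (X : V) : V := ph F V α X - psiT F V α X

/-- The 2-forms `Θ_α(X,Y) = g(X, θ_α Y)`. -/
def ThetaForm (α : Fin 3) (X Y : V) : F := gm F V X (thetaT F V α Y)

end tqs

/-- The 3-quasi-Sasakian manifold has rank `4l+3`: the constant `c` is nonzero
and the orthonormal frame is adapted to the splitting
`TM = E^{4l} ⊕ E^{4m} ⊕ ⟨ξ₁,ξ₂,ξ₃⟩` with `dim E^{4l} = 4l` (hence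
`dim E^{4m} = 4m`, `m = n - l`, and the rank of the `η_α` is `4l+3`). -/
class HasRank (F V : Type) [CommRing F] [Algebra ℝ F] [AddCommGroup V] [Module F V]
    [SmoothSetting F V] [ACM3 F V] [ThreeQS F V] (l : ℕ) : Prop where
  c_ne : cc F V ≠ 0
  l_le : l ≤ dimn F V
  frame_E4l : ∀ i : Fin (4 * dimn F V + 3), i.val < 4 * l → InE4l F V (fr F V i)
  frame_E4m : ∀ i : Fin (4 * dimn F V + 3), 4 * l ≤ i.val → i.val < 4 * dimn F V →
    InE4m F V (fr F V i)
  frame_xi : ∀ (i : Fin (4 * dimn F V + 3)) (a : Fin 3),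
    i.val = 4 * dimn F V + a.val → fr F V i = rxi F V a

/-- The Levi-Civita connection of `g`: the unique torsion-free metric connection. -/
class LeviCivita (F V : Type) [CommRing F] [Algebra ℝ F] [AddCommGroup V] [Module F V]
    [SmoothSetting F V] [ACM3 F V] where
  nabla : V → V → V
  nabla_addLeft : ∀ X Y Z : V, nabla (X + Y) Z = nabla X Z + nabla Y Z
  nabla_smulLeft : ∀ (f : F) (X Y : V), nabla (f • X) Y = f • nabla X Y
  nabla_addRight : ∀ X Y Z : V, nabla X (Y + Z) = nabla X Y + nabla X Z
  nabla_leibniz : ∀ (X : V) (f : F) (Y : V),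
    nabla X (f • Y) = der F V X f • Y + f • nabla X Y
  nabla_metric : ∀ X Y Z : V,
    der F V X (gm F V Y Z) = gm F V (nabla X Y) Z + gm F V Y (nabla X Z)
  nabla_torsionFree : ∀ X Y : V, nabla X Y - nabla Y X = lie F V X Y

section curv

variable (F V : Type) [CommRing F] [Algebra ℝ F] [AddCommGroup V] [Module F V]
  [SmoothSetting F V] [ACM3 F V] [LeviCivita F V]

/-- The Levi-Civita covariant derivative `∇_X Y`. -/
def nab (X Y : V) : V := LeviCivita.nabla F X Y

/-- The Riemannian curvature `R(X,Y)Z = ∇_X ∇_Y Z - ∇_Y ∇_X Z - ∇_{[X,Y]} Z`. -/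
def Rcurv (X Y Z : V) : V :=
  nab F V X (nab F V Y Z) - nab F V Y (nab F V X Z) - nab F V (lie F V X Y) Z

/-- The Ricci tensor `Ric(X,Y) = ∑_i g(R(e_i, X)Y, e_i)`. -/
def Ric (X Y : V) : F :=
  ∑ i, gm F V (Rcurv F V (fr F V i) X Y) (fr F V i)

/-- The scalar curvature. -/
def Scal : F := ∑ i, Ric F V (fr F V i) (fr F V i)

/-- `M` is Einstein: `Ric = a g` for a constant `a`. -/
def Einstein : Prop :=
  ∃ a : ℝ, ∀ X Y, Ric F V X Y = algebraMap ℝ F a * gm F V X Y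

/-- `M` is η-Einstein: `Ric = a g + b ∑_α η_α ⊗ η_α` for constants `a, b`. -/
def EtaEinstein : Prop :=
  ∃ a b : ℝ, ∀ X Y, Ric F V X Y
    = algebraMap ℝ F a * gm F V X Y
      + algebraMap ℝ F b * ∑ α : Fin 3, et F V α X * et F V α Y

end curv

/-- A (Koszul) linear connection on vector fields. -/
def IsConnection (F V : Type) [CommRing F] [Algebra ℝ F] [AddCommGroup V] [Module F V]
    [SmoothSetting F V] (D : V → V → V) : Prop :=
  (∀ X Y Z : V, D (X + Y) Z = D X Z + D Y Z) ∧
  (∀ (f : F) (X Y : V), D (f • X) Y = f • D X Y) ∧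
  (∀ X Y Z : V, D X (Y + Z) = D X Y + D X Z) ∧
  (∀ (X : V) (f : F) (Y : V), D X (f • Y) = der F V X f • Y + f • D X Y)

end QS3

namespace QS3

section Forms

variable {F V : Type} [CommRing F] [AddCommGroup V] [Module F V]

/-- The pointwise conditions making `θ` a 1-form. -/
structure IsOneForm (θ : V → F) : Prop where
  add : ∀ X Y, θ (X + Y) = θ X + θ Y
  smul : ∀ (f : F) X, θ (f • X) = f * θ X

/-- The pointwise conditions making `ω` a 2-form. -/
structure IsTwoForm (ω : V → V → F) : Prop where
  anti : ∀ X Y, ω X Y = -ω Y X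
  left : ∀ Y, IsOneForm (fun X => ω X Y)

namespace IsOneForm

variable {θ : V → F}

theorem zero (h : IsOneForm θ) : θ 0 = 0 := by simpa using h.add 0 0

theorem neg (h : IsOneForm θ) (X : V) : θ (-X) = -θ X := by
  have := h.add X (-X)
  rw [add_neg_cancel, h.zero] at this
  linear_combination -this

theorem sub (h : IsOneForm θ) (X Y : V) : θ (X - Y) = θ X - θ Y := by
  rw [sub_eq_add_neg, h.add, h.neg, ← sub_eq_add_neg]

theorem sum (h : IsOneForm θ) {ι : Type} (s : Finset ι) (v : ι → V) :
    θ (∑ i ∈ s, v i) = ∑ i ∈ s, θ (v i) := by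
  classical
  induction s using Finset.induction_on with
  | empty => simpa using h.zero
  | insert i s hi ih => rw [Finset.sum_insert hi, Finset.sum_insert hi, h.add, ih]

end IsOneForm

theorem IsTwoForm.right {ω : V → V → F} (h : IsTwoForm ω) (X : V) : IsOneForm (ω X) where
  add Y Z := by rw [h.anti, (h.left X).add, h.anti X, h.anti X]; ring
  smul f Y := by rw [h.anti, (h.left X).smul, h.anti X]; ring

end Forms

section Calculus

variable {F V : Type} [CommRing F] [Algebra ℝ F] [AddCommGroup V] [Module F V]

theorem two_mul_cancel {x y : F} (h : 2 * x = 2 * y) : x = y := by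
  have h2 : algebraMap ℝ F (2 : ℝ)⁻¹ * 2 = 1 := by
    rw [← map_ofNat (algebraMap ℝ F) 2, ← map_mul]; norm_num
  linear_combination (-(x - y)) * h2 + algebraMap ℝ F (2 : ℝ)⁻¹ * h

theorem two_smul_cancel {x y : V} (h : (2 : F) • x = (2 : F) • y) : x = y := by
  have h2 : algebraMap ℝ F (2 : ℝ)⁻¹ * 2 = 1 := by
    rw [← map_ofNat (algebraMap ℝ F) 2, ← map_mul]; norm_num
  rw [← one_smul F x, ← one_smul F y, ← h2, mul_smul, mul_smul, h]

variable [SmoothSetting F V]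

theorem der_add (X : V) (f h : F) : der F V X (f + h) = der F V X f + der F V X h :=
  SmoothSetting.act_add X f h

theorem der_mul (X : V) (f h : F) :
    der F V X (f * h) = der F V X f * h + f * der F V X h :=
  SmoothSetting.act_mul X f h

theorem der_algebraMap (X : V) (r : ℝ) : der F V X (algebraMap ℝ F r) = 0 :=
  SmoothSetting.act_const X r

theorem der_zero (X : V) : der F V X 0 = 0 := by
  simpa using der_algebraMap (F := F) X 0

theorem der_one (X : V) : der F V X 1 = 0 := by
  simpa using der_algebraMap (F := F) X 1

theorem der_neg (X : V) (f : F) : der F V X (-f) = -der F V X f := by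
  have h := der_add X f (-f)
  rw [add_neg_cancel, der_zero] at h
  linear_combination -h

theorem der_sub (X : V) (f h : F) : der F V X (f - h) = der F V X f - der F V X h := by
  rw [sub_eq_add_neg, der_add, der_neg, ← sub_eq_add_neg]

theorem der_algebraMap_mul (X : V) (r : ℝ) (f : F) :
    der F V X (algebraMap ℝ F r * f) = algebraMap ℝ F r * der F V X f := by
  rw [der_mul, der_algebraMap]; ring

theorem der_two_mul (X : V) (f : F) : der F V X (2 * f) = 2 * der F V X f := by
  simpa only [map_ofNat] using der_algebraMap_mul X 2 f

theorem der_add_left (X Y : V) (f : F) :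
    der F V (X + Y) f = der F V X f + der F V Y f :=
  SmoothSetting.act_addLeft X Y f

theorem der_smul_left (f : F) (X : V) (h : F) :
    der F V (f • X) h = f * der F V X h :=
  SmoothSetting.act_smulLeft f X h

theorem der_lie (X Y : V) (f : F) :
    der F V (lie F V X Y) f = der F V X (der F V Y f) - der F V Y (der F V X f) :=
  SmoothSetting.bracket_act X Y f

theorem lie_anti (X Y : V) : lie F V X Y = -lie F V Y X :=
  SmoothSetting.bracket_antisymm X Y

theorem lie_add_left (X Y Z : V) :
    lie F V (X + Y) Z = lie F V X Z + lie F V Y Z :=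
  SmoothSetting.bracket_addLeft X Y Z

theorem lie_add_right (X Y Z : V) :
    lie F V X (Y + Z) = lie F V X Y + lie F V X Z := by
  rw [lie_anti, lie_add_left, lie_anti Y, lie_anti Z]; abel

theorem lie_self (X : V) : lie F V X X = 0 := by
  apply two_smul_cancel (F := F)
  rw [two_smul, smul_zero]
  nth_rewrite 1 [lie_anti]
  simp

theorem lie_zero_right (X : V) : lie F V X 0 = 0 := by
  simpa using lie_add_right (F := F) X 0 0

theorem lie_neg_right (X Y : V) : lie F V X (-Y) = -lie F V X Y := by
  have h := lie_add_right (F := F) X Y (-Y)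
  rw [add_neg_cancel, lie_zero_right] at h
  exact (neg_eq_of_add_eq_zero_right h.symm).symm

theorem lie_smul_right (X : V) (f : F) (Y : V) :
    lie F V X (f • Y) = f • lie F V X Y + der F V X f • Y :=
  SmoothSetting.bracket_smulRight X f Y

theorem lie_smul_left (X : V) (f : F) (Y : V) :
    lie F V (f • X) Y = f • lie F V X Y - der F V Y f • X := by
  rw [lie_anti, lie_smul_right, lie_anti Y X]; module

theorem lie_lie (X Y Z : V) :
    lie F V (lie F V X Y) Z = lie F V X (lie F V Y Z) - lie F V Y (lie F V X Z) := by
  have h : lie F V X (lie F V Y Z) + lie F V Y (lie F V Z X) + lie F V Z (lie F V X Y) = 0 :=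
    SmoothSetting.jacobi X Y Z
  rw [lie_anti Z X, lie_neg_right, lie_anti Z] at h
  rw [← sub_eq_zero, ← neg_eq_zero, ← h]
  abel

/-- The Lie derivative of a 2-form. -/
def lieDeriv (Z : V) (ω : V → V → F) (X Y : V) : F :=
  der F V Z (ω X Y) - ω (lie F V Z X) Y - ω X (lie F V Z Y)

theorem two_mul_dOne (θ : V → F) (X Y : V) :
    2 * dOne F V θ X Y = der F V X (θ Y) - der F V Y (θ X) - θ (lie F V X Y) := by
  have h2 : algebraMap ℝ F (2 : ℝ)⁻¹ * 2 = 1 := by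
    rw [← map_ofNat (algebraMap ℝ F) 2, ← map_mul]; norm_num
  rw [dOne, Algebra.smul_def]
  linear_combination (der F V X (θ Y) - der F V Y (θ X) - θ (lie F V X Y)) * h2

theorem IsOneForm.dOne_isTwoForm {θ : V → F} (h : IsOneForm θ) : IsTwoForm (dOne F V θ) where
  anti X Y := by
    apply two_mul_cancel
    rw [mul_neg, two_mul_dOne, two_mul_dOne, lie_anti Y X, h.neg]; ring
  left Z :=
    { add := fun X Y => by
        apply two_mul_cancel
        rw [mul_add, two_mul_dOne, two_mul_dOne, two_mul_dOne, lie_add_left, h.add, h.add,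
          der_add_left, der_add]
        ring
      smul := fun f X => by
        apply two_mul_cancel
        rw [mul_left_comm, two_mul_dOne, two_mul_dOne, lie_smul_left, h.sub, h.smul, h.smul, h.smul,
          der_smul_left, der_mul]
        ring }

theorem dTwo_eq_zero_iff (ω : V → V → F) (X Y Z : V) :
    dTwo F V ω X Y Z = 0 ↔ der F V X (ω Y Z) + der F V Y (ω Z X) + der F V Z (ω X Y)
      - ω (lie F V X Y) Z - ω (lie F V Y Z) X - ω (lie F V Z X) Y = 0 := by
  rw [dTwo]
  constructor
  · intro h
    have := congrArg (fun x => (3 : ℝ) • x) h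
    simpa [smul_smul] using this
  · intro h
    rw [h, smul_zero]

/-- Cartan's formula for a closed 2-form. -/
theorem lieDeriv_eq_dOne {ω : V → V → F} (h : IsTwoForm ω) (hc : IsClosedTwo F V ω)
    (Z X Y : V) : lieDeriv Z ω X Y = 2 * dOne F V (ω Z) X Y := by
  have h0 := (dTwo_eq_zero_iff ω Z X Y).1 (hc Z X Y)
  rw [two_mul_dOne, lieDeriv]
  have e1 : der F V X (ω Y Z) = -der F V X (ω Z Y) := by rw [h.anti, der_neg]
  have e2 : ω (lie F V Y Z) X = ω X (lie F V Z Y) := by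
    rw [lie_anti, (h.left X).neg, h.anti, neg_neg]
  linear_combination h0 - e1 + e2 + h.anti (lie F V X Y) Z

theorem lieDeriv_eq_zero {ω : V → V → F} (h : IsTwoForm ω) (hc : IsClosedTwo F V ω)
    {Z : V} (hZ : ∀ X, ω Z X = 0) (X Y : V) : lieDeriv Z ω X Y = 0 := by
  rw [lieDeriv_eq_dOne h hc, two_mul_dOne]
  simp [hZ, der_zero]

theorem lieDeriv_dOne (θ : V → F) (h : IsOneForm θ) (Z X Y : V) :
    lieDeriv Z (dOne F V θ) X Y
      = dOne F V (fun U => der F V Z (θ U) - θ (lie F V Z U)) X Y := by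
  apply two_mul_cancel
  rw [lieDeriv, two_mul_dOne, mul_sub, mul_sub, ← der_two_mul, two_mul_dOne, two_mul_dOne,
    two_mul_dOne, der_sub, der_sub, der_sub, der_sub, der_lie, der_lie, lie_lie, h.sub]
  ring

theorem IsOneForm.isClosedTwo_dOne {θ : V → F} (h : IsOneForm θ) :
    IsClosedTwo F V (dOne F V θ) := by
  intro X Y Z
  have h2 := h.dOne_isTwoForm
  have h1 := congrArg (2 * ·) (lieDeriv_dOne θ h X Y Z)
  simp only [lieDeriv, two_mul_dOne] at h1
  rw [dTwo_eq_zero_iff]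
  apply two_mul_cancel
  rw [h2.anti (lie F V Y Z), lie_anti Z X, (h2.left Y).neg, h2.anti (lie F V X Z), h2.anti Z X,
    der_neg]
  have e1 : 2 * dOne F V θ X (lie F V Y Z) = _ := two_mul_dOne θ X (lie F V Y Z)
  have e2 := congrArg (der F V Y) (two_mul_dOne θ X Z)
  have e3 := congrArg (der F V Z) (two_mul_dOne θ X Y)
  rw [der_two_mul, der_sub, der_sub] at e2 e3
  rw [der_sub, der_sub] at h1
  rw [der_lie] at e1
  linear_combination h1 + e1 - e2 + e3

end Calculus

section Structure

variable {F V : Type} [CommRing F] [Algebra ℝ F] [AddCommGroup V] [Module F V]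
  [SmoothSetting F V] [ACM3 F V]

theorem Cyclic.rotate {a b c : Fin 3} (h : Cyclic a b c) : Cyclic b c a := by
  revert h
  unfold Cyclic
  revert a b c
  decide

theorem Cyclic.eq_or_eq_or_eq {a b c : Fin 3} (h : Cyclic a b c) (α : Fin 3) :
    α = a ∨ α = b ∨ α = c := by
  revert h
  unfold Cyclic
  revert a b c α
  decide

theorem exists_cyclic (c : Fin 3) : ∃ a b, Cyclic a b c := by
  unfold Cyclic
  revert c
  decide

theorem eq_or_cyclic (a b : Fin 3) : a = b ∨ (∃ c, Cyclic a b c) ∨ ∃ c, Cyclic b a c := by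
  unfold Cyclic
  revert a b
  decide

theorem gm_symm (X Y : V) : gm F V X Y = gm F V Y X := ACM3.g_symm X Y

theorem gm_left (Y : V) : IsOneForm (fun X => gm F V X Y) where
  add X Z := ACM3.g_addLeft X Z Y
  smul f X := ACM3.g_smulLeft f X Y

theorem gm_right (X : V) : IsOneForm (gm F V X) where
  add Y Z := by rw [gm_symm, (gm_left X).add, gm_symm X, gm_symm X]
  smul f Y := by rw [gm_symm, (gm_left X).smul, gm_symm X]

theorem eq_of_gm {X Y : V} (h : ∀ Z, gm F V Z X = gm F V Z Y) : X = Y := by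
  refine sub_eq_zero.1 (ACM3.g_nondeg (F := F) _ fun Z => ?_)
  change gm F V (X - Y) Z = 0
  rw [(gm_left Z).sub, gm_symm X, gm_symm Y, h, sub_self]

theorem et_eq (α : Fin 3) (X : V) : et F V α X = gm F V X (rxi F V α) := ACM3.eta_eq α X

theorem et_isOneForm (α : Fin 3) : IsOneForm (et F V α) := by
  rw [show et F V α = fun X => gm F V X (rxi F V α) from funext (et_eq α)]
  exact gm_left _

theorem ph_add (α : Fin 3) (X Y : V) : ph F V α (X + Y) = ph F V α X + ph F V α Y :=
  ACM3.phi_add α X Y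

theorem ph_smul (α : Fin 3) (f : F) (X : V) : ph F V α (f • X) = f • ph F V α X :=
  ACM3.phi_smul α f X

theorem ph_neg (α : Fin 3) (X : V) : ph F V α (-X) = -ph F V α X := by
  rw [← neg_one_smul F, ph_smul, neg_one_smul]

theorem ph_sub (α : Fin 3) (X Y : V) : ph F V α (X - Y) = ph F V α X - ph F V α Y := by
  rw [sub_eq_add_neg, ph_add, ph_neg, ← sub_eq_add_neg]

theorem ph_zero (α : Fin 3) : ph F V α 0 = 0 := by
  simpa using ph_smul (F := F) (V := V) α 0 0

theorem ph_ph (α : Fin 3) (X : V) :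
    ph F V α (ph F V α X) = -X + et F V α X • rxi F V α := ACM3.acm_sq α X

theorem et_rxi (α : Fin 3) : et F V α (rxi F V α) = 1 := ACM3.eta_xi α

theorem gm_ph_ph (α : Fin 3) (X Y : V) :
    gm F V (ph F V α X) (ph F V α Y) = gm F V X Y - et F V α X * et F V α Y :=
  ACM3.compat α X Y

theorem Cyclic.ph_eq {a b c : Fin 3} (h : Cyclic a b c) (X : V) :
    ph F V c X = ph F V a (ph F V b X) - et F V b X • rxi F V a := ACM3.quat_phi a b c h X

theorem Cyclic.ph_eq_neg {a b c : Fin 3} (h : Cyclic a b c) (X : V) :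
    ph F V c X = -ph F V b (ph F V a X) + et F V a X • rxi F V b := ACM3.quat_phi' a b c h X

theorem Cyclic.ph_eq_of_horiz {a b c : Fin 3} (h : Cyclic a b c) {X : V} (hX : Horiz F V X) :
    ph F V c X = ph F V a (ph F V b X) := by
  rw [h.ph_eq, hX, zero_smul, sub_zero]

theorem Cyclic.ph_eq_neg_of_horiz {a b c : Fin 3} (h : Cyclic a b c) {X : V}
    (hX : Horiz F V X) : ph F V c X = -ph F V b (ph F V a X) := by
  rw [h.ph_eq_neg, hX, zero_smul, add_zero]

theorem Cyclic.ph_rxi {a b c : Fin 3} (h : Cyclic a b c) : ph F V a (rxi F V b) = rxi F V c :=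
  (ACM3.quat_xi a b c h).symm

theorem Cyclic.ph_rxi_neg {a b c : Fin 3} (h : Cyclic a b c) :
    ph F V b (rxi F V a) = -rxi F V c := by
  rw [eq_neg_iff_add_eq_zero, add_comm, ← eq_neg_iff_add_eq_zero]
  exact ACM3.quat_xi' a b c h

theorem Cyclic.et_ph {a b c : Fin 3} (h : Cyclic a b c) (X : V) :
    et F V a (ph F V b X) = et F V c X :=
  (ACM3.quat_eta a b c h X).symm

theorem Cyclic.et_ph_neg {a b c : Fin 3} (h : Cyclic a b c) (X : V) :
    et F V b (ph F V a X) = -et F V c X := by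
  rw [eq_neg_iff_add_eq_zero, add_comm, ← eq_neg_iff_add_eq_zero]
  exact ACM3.quat_eta' a b c h X

theorem Cyclic.et_rxi {a b c : Fin 3} (h : Cyclic a b c) : et F V c (rxi F V a) = 0 := by
  have h1 : et F V a (ph F V b (rxi F V a)) = _ := h.et_ph (rxi F V a)
  rw [h.ph_rxi_neg, (et_isOneForm a).neg, et_eq, et_eq, gm_symm] at h1
  apply two_mul_cancel
  rw [et_eq]
  linear_combination -h1

theorem Cyclic.et_rxi_rev {a b c : Fin 3} (h : Cyclic a b c) : et F V a (rxi F V c) = 0 := by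
  have h1 := h.et_rxi (F := F) (V := V)
  rwa [et_eq, gm_symm, ← et_eq] at h1

theorem et_rxi_of_ne {α β : Fin 3} (h : α ≠ β) : et F V α (rxi F V β) = 0 := by
  obtain rfl | ⟨c, h⟩ | ⟨c, h⟩ := eq_or_cyclic α β
  · exact absurd rfl h
  · exact h.rotate.et_rxi
  · exact h.rotate.et_rxi_rev

theorem ph_rxi_self (α : Fin 3) : ph F V α (rxi F V α) = 0 := by
  obtain ⟨c, a, h0⟩ := exists_cyclic α
  have h : Cyclic a α c := h0.rotate
  set f := et F V α (ph F V α (rxi F V α)) with hf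
  have h1 : ph F V α (rxi F V α) = f • rxi F V α := by
    have h3 := ph_ph (F := F) α (ph F V α (rxi F V α))
    rw [ph_ph α (rxi F V α), et_rxi, one_smul, neg_add_cancel, ph_zero, ← hf] at h3
    rw [← sub_eq_zero, ← neg_eq_zero, h3]; abel
  have h2 : ph F V a (ph F V α (rxi F V α)) = 0 := by
    have h3 := h.ph_eq (F := F) (rxi F V α)
    rw [h.rotate.ph_rxi_neg, et_rxi, one_smul] at h3
    rwa [eq_comm, sub_eq_neg_self] at h3
  rw [h1, ph_smul, h.ph_rxi] at h2
  have h4 := congrArg (et F V c) h2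
  rw [(et_isOneForm c).smul, et_rxi, (et_isOneForm c).zero, mul_one] at h4
  rw [h1, h4, zero_smul]

theorem et_ph_self (α : Fin 3) (X : V) : et F V α (ph F V α X) = 0 := by
  have h1 := ph_ph (F := F) α (ph F V α X)
  rw [ph_ph α X, ph_add, ph_neg, ph_smul, ph_rxi_self, smul_zero, add_zero, left_eq_add] at h1
  have h2 := congrArg (et F V α) h1
  rwa [(et_isOneForm α).smul, et_rxi, (et_isOneForm α).zero, mul_one] at h2

theorem gm_ph_left (α : Fin 3) (X Y : V) :
    gm F V (ph F V α X) Y = -gm F V X (ph F V α Y) := by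
  have h := gm_ph_ph (F := F) α X (ph F V α Y)
  rw [ph_ph, (gm_right _).add, (gm_right _).neg, (gm_right _).smul, ← et_eq, et_ph_self,
    et_ph_self] at h
  linear_combination -h

theorem gm_ph_right (α : Fin 3) (X Y : V) :
    gm F V X (ph F V α Y) = -gm F V (ph F V α X) Y := by
  rw [gm_ph_left, neg_neg]

theorem Phi_isTwoForm (α : Fin 3) : IsTwoForm (Phi F V α) where
  anti X Y := by rw [Phi, Phi, gm_symm (F := F), gm_ph_left]
  left Y := gm_left _

theorem Phi_rxi_left (α β : Fin 3) (X : V) :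
    Phi F V α (rxi F V β) X = et F V β (ph F V α X) := by
  rw [Phi, gm_symm (F := F), et_eq]

theorem horiz_ph {X : V} (hX : Horiz F V X) (α : Fin 3) : Horiz F V (ph F V α X) := by
  intro β
  obtain rfl | ⟨c, h⟩ | ⟨c, h⟩ := eq_or_cyclic β α
  · exact et_ph_self _ _
  · rw [h.et_ph, hX]
  · rw [h.et_ph_neg, hX, neg_zero]

theorem gm_horiz_ph_rxi {X : V} (hX : Horiz F V X) (α β : Fin 3) :
    gm F V X (ph F V α (rxi F V β)) = 0 := by
  have h := horiz_ph hX α β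
  rw [et_eq, gm_ph_left] at h
  exact neg_eq_zero.1 h

theorem horiz_sub_sum (Z : V) : Horiz F V (Z - ∑ α, et F V α Z • rxi F V α) := by
  intro β
  rw [(et_isOneForm β).sub, (et_isOneForm β).sum, Finset.sum_eq_single β]
  · rw [(et_isOneForm β).smul, et_rxi, mul_one, sub_self]
  · intro α _ hα
    rw [(et_isOneForm β).smul, et_rxi_of_ne hα.symm, mul_zero]
  · simp

theorem eq_of_gm_horiz {X Y : V} (hX : Horiz F V X) (hY : Horiz F V Y)
    (h : ∀ Z, Horiz F V Z → gm F V Z X = gm F V Z Y) : X = Y := by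
  refine eq_of_gm (F := F) fun Z => ?_
  have h0 : ∀ W, Horiz F V W → gm F V (∑ α, et F V α Z • rxi F V α) W = 0 := by
    intro W hW
    rw [(gm_left W).sum]
    refine Finset.sum_eq_zero fun α _ => ?_
    rw [(gm_left W).smul, gm_symm, ← et_eq, hW, mul_zero]
  have h1 := h _ (horiz_sub_sum Z)
  rwa [(gm_left X).sub, (gm_left Y).sub, h0 X hX, h0 Y hY, sub_zero, sub_zero] at h1

/-- The endomorphism `A_α` with `dη_α(X, Y) = g(X, A_α Y)`. -/
def etaEndo (F V : Type) [CommRing F] [Algebra ℝ F] [AddCommGroup V] [Module F V]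
    [SmoothSetting F V] [ACM3 F V] (α : Fin 3) (Y : V) : V :=
  ∑ i, dOne F V (et F V α) (fr F V i) Y • fr F V i

theorem dEt_isTwoForm (α : Fin 3) : IsTwoForm (dOne F V (et F V α)) :=
  (et_isOneForm α).dOne_isTwoForm

theorem gm_etaEndo (α : Fin 3) (X Y : V) :
    gm F V X (etaEndo F V α Y) = dOne F V (et F V α) X Y := by
  have hX : X = ∑ i, gm F V X (fr F V i) • fr F V i := ACM3.frame_span X
  conv_rhs => rw [hX, ((dEt_isTwoForm α).left Y).sum]
  rw [etaEndo, (gm_right X).sum]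
  simp only [(gm_right X).smul, ((dEt_isTwoForm α).left Y).smul, mul_comm]

theorem gm_etaEndo_left (α : Fin 3) (X Y : V) :
    gm F V (etaEndo F V α X) Y = -gm F V X (etaEndo F V α Y) := by
  rw [gm_symm, gm_etaEndo, gm_etaEndo, (dEt_isTwoForm α).anti]

theorem etaEndo_add (α : Fin 3) (X Y : V) :
    etaEndo F V α (X + Y) = etaEndo F V α X + etaEndo F V α Y := by
  refine eq_of_gm (F := F) fun Z => ?_
  rw [(gm_right Z).add, gm_etaEndo, gm_etaEndo, gm_etaEndo, ((dEt_isTwoForm α).right Z).add]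

theorem etaEndo_smul (α : Fin 3) (f : F) (X : V) :
    etaEndo F V α (f • X) = f • etaEndo F V α X := by
  refine eq_of_gm (F := F) fun Z => ?_
  rw [(gm_right Z).smul, gm_etaEndo, gm_etaEndo, ((dEt_isTwoForm α).right Z).smul]

theorem dEt_isClosedTwo (α : Fin 3) : IsClosedTwo F V (dOne F V (et F V α)) :=
  (et_isOneForm α).isClosedTwo_dOne

theorem Cyclic.Phi_ph {a b c : Fin 3} (h : Cyclic a b c) (X Y : V) :
    Phi F V a X (ph F V c Y) = -Phi F V b X Y + et F V a X * et F V c Y := by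
  rw [Phi, Phi, h.rotate.rotate.ph_eq_neg, (gm_right X).add, (gm_right X).neg, (gm_right X).smul,
    ← et_eq]
  ring

theorem inVert_sum (Z : V) : InVert F V (∑ α, et F V α Z • rxi F V α) :=
  ⟨_, _, _, Fin.sum_univ_three _⟩

theorem gm_inVert_horiz {X Y : V} (hX : InVert F V X) (hY : Horiz F V Y) :
    gm F V X Y = 0 := by
  obtain ⟨p, q, r, rfl⟩ := hX
  simp only [(gm_left Y).add, (gm_left Y).smul, gm_symm (F := F) _ Y, ← et_eq, hY _, mul_zero,
    add_zero]

theorem dEt_E4m_right (α : Fin 3) (X : V) {W : V} (hW : InE4m F V W) :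
    dOne F V (et F V α) X W = 0 := by
  rw [(dEt_isTwoForm α).anti, hW.2, neg_zero]

/-- `η_α` is projectable. -/
theorem et_lie_E4m {W : V} (hW : InE4m F V W) (α : Fin 3) (X : V) :
    et F V α (lie F V W X) = der F V W (et F V α X) := by
  have h := two_mul_dOne (et F V α) W X
  rw [hW.2, hW.1, der_zero] at h
  linear_combination h

theorem gm_E4l3_E4m {X W : V} (hX : InE4l3 F V X) (hW : InE4m F V W) : gm F V X W = 0 := by
  obtain ⟨Y, Z, hY, hZ, rfl⟩ := hX
  rw [(gm_left W).add, hY.2 W hW, gm_inVert_horiz hZ hW.1, add_zero]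

theorem dEt_lie_E4m {W : V} (hW : InE4m F V W) (α : Fin 3) (X Y : V) :
    der F V W (dOne F V (et F V α) X Y)
      = dOne F V (et F V α) (lie F V W X) Y + dOne F V (et F V α) X (lie F V W Y) := by
  have h := lieDeriv_eq_zero (dEt_isTwoForm (F := F) α) (dEt_isClosedTwo α) (hW.2 α) X Y
  rw [lieDeriv] at h
  linear_combination h

theorem inE4m_lie {X Y : V} (hX : InE4m F V X) (hY : InE4m F V Y) :
    InE4m F V (lie F V X Y) := by
  refine ⟨fun α => by rw [et_lie_E4m hX, hY.1, der_zero], fun α Z => ?_⟩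
  have h := dEt_lie_E4m hX α Y Z
  rw [hY.2, hY.2, der_zero, add_zero] at h
  exact h.symm

section LeviCivita

variable [LeviCivita F V]

theorem der_gm_nab (X Y Z : V) :
    der F V X (gm F V Y Z) = gm F V (nab F V X Y) Z + gm F V Y (nab F V X Z) :=
  LeviCivita.nabla_metric X Y Z

theorem lie_eq_nab (X Y : V) : lie F V X Y = nab F V X Y - nab F V Y X :=
  (LeviCivita.nabla_torsionFree X Y).symm

theorem nab_neg_right (X Y : V) : nab F V X (-Y) = -nab F V X Y := by
  have h := (LeviCivita.nabla_leibniz X (-1 : F) Y : nab F V X ((-1 : F) • Y) = _)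
  rw [neg_one_smul, neg_one_smul, der_neg, der_one, neg_zero, zero_smul, zero_add] at h
  exact h

/-- `g((∇_X φ_α) Y, Z)`. -/
def nabPh (F V : Type) [CommRing F] [Algebra ℝ F] [AddCommGroup V] [Module F V]
    [SmoothSetting F V] [ACM3 F V] [LeviCivita F V] (α : Fin 3) (X Y Z : V) : F :=
  gm F V Z (nab F V X (ph F V α Y)) - gm F V Z (ph F V α (nab F V X Y))

theorem nabPh_anti (α : Fin 3) (X Y Z : V) : nabPh F V α X Y Z = -nabPh F V α X Z Y := by
  have h1 := der_gm_nab (F := F) X Z (ph F V α Y)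
  have h2 := der_gm_nab (F := F) X Y (ph F V α Z)
  rw [gm_ph_right, gm_symm, der_neg, gm_symm (nab F V X Z), gm_ph_left] at h1
  rw [gm_symm (nab F V X Y), gm_ph_left] at h2
  rw [nabPh, nabPh]
  linear_combination -h1 - h2

theorem nabPh_neg_right (α : Fin 3) (X Y Z : V) : nabPh F V α X Y (-Z) = -nabPh F V α X Y Z := by
  rw [nabPh, nabPh, (gm_left _).neg, (gm_left _).neg]
  ring

theorem nabPh_ph_middle (α : Fin 3) (X : V) {Y Z : V} (hY : et F V α Y = 0)
    (hZ : et F V α Z = 0) :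
    nabPh F V α X (ph F V α Y) Z = nabPh F V α X Y (ph F V α Z) := by
  rw [nabPh, nabPh, ph_ph, hY, zero_smul, add_zero, nab_neg_right, (gm_right Z).neg, gm_ph_ph, hZ,
    gm_ph_left]
  ring

theorem nabPh_cyclic {α : Fin 3} (h : IsClosedTwo F V (Phi F V α)) (X Y Z : V) :
    nabPh F V α X Y Z + nabPh F V α Y Z X + nabPh F V α Z X Y = 0 := by
  have h1 := (dTwo_eq_zero_iff _ X Y Z).1 (h X Y Z)
  simp only [Phi, der_gm_nab, lie_eq_nab, (gm_left _).sub] at h1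
  have e : ∀ A B : V, gm F V A (ph F V α B) = -gm F V B (ph F V α A) :=
    (Phi_isTwoForm α).anti
  rw [nabPh_anti α X, nabPh_anti α Y, nabPh_anti α Z, nabPh, nabPh, nabPh]
  linear_combination -h1 + e (nab F V X Z) Y + e (nab F V Y X) Z + e (nab F V Z Y) X

theorem nabPh_of_isNormal {α : Fin 3} (h : IsNormal F V α) {X Y Z : V}
    (hXY : dOne F V (et F V α) X Y = 0) (hZ : et F V α Z = 0) :
    nabPh F V α (ph F V α X) Y Z - nabPh F V α (ph F V α Y) X Z
      - nabPh F V α Y X (ph F V α Z) + nabPh F V α X Y (ph F V α Z) = 0 := by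
  have h1 := h X Y
  rw [NOne, hXY, smul_zero, zero_smul, add_zero, Nij] at h1
  have h2 := congrArg (gm F V Z) h1
  simp only [(gm_right Z).sub, (gm_right Z).add, (gm_right Z).zero, lie_eq_nab, ph_sub, ph_ph,
    (gm_right Z).neg, (gm_right Z).smul, ← et_eq, hZ] at h2
  simp only [nabPh, gm_ph_left, ph_ph, (gm_right Z).add, (gm_right Z).neg, (gm_right Z).smul,
    ← et_eq, hZ]
  linear_combination h2

end LeviCivita

end Structure

section Reeb

variable {F V : Type} [CommRing F] [Algebra ℝ F] [AddCommGroup V] [Module F V]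
  [SmoothSetting F V] [ACM3 F V] [ThreeQS F V]

theorem lie_rxi_ph_aux (α : Fin 3) (X : V) :
    -lie F V (rxi F V α) X - ph F V α (lie F V (rxi F V α) (ph F V α X))
      + der F V (rxi F V α) (et F V α X) • rxi F V α = 0 := by
  have h : NOne F V α (rxi F V α) X = 0 := (ThreeQS.qs (F := F) α).1 _ _
  have h2 : (2 : ℝ) • dOne F V (et F V α) (rxi F V α) X
      = der F V (rxi F V α) (et F V α X) - der F V X (et F V α (rxi F V α))
        - et F V α (lie F V (rxi F V α) X) := by
    rw [← two_mul_dOne, Algebra.smul_def, map_ofNat]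
  rw [NOne, Nij, h2, et_rxi, der_one, ph_ph, ph_rxi_self, lie_anti 0, lie_zero_right, lie_anti 0,
    lie_zero_right, neg_zero, ph_zero] at h
  rw [← h]
  module

/-- `L_{ξ_α} η_α = 0`. -/
theorem et_lie_rxi_self (α : Fin 3) (X : V) :
    et F V α (lie F V (rxi F V α) X) = der F V (rxi F V α) (et F V α X) := by
  have h := congrArg (et F V α) (lie_rxi_ph_aux (F := F) α X)
  rw [(et_isOneForm α).add, (et_isOneForm α).sub, (et_isOneForm α).neg, (et_isOneForm α).smul,
    et_ph_self, et_rxi, (et_isOneForm α).zero] at h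
  linear_combination -h

/-- `L_{ξ_α} φ_α = 0`. -/
theorem lie_rxi_ph_self (α : Fin 3) (X : V) :
    lie F V (rxi F V α) (ph F V α X) = ph F V α (lie F V (rxi F V α) X) := by
  have h := lie_rxi_ph_aux (F := F) α (ph F V α X)
  rw [ph_ph, et_ph_self, der_zero, lie_add_right, lie_neg_right, lie_smul_right, lie_self, ph_add,
    ph_neg, ph_add, ph_smul, ph_smul, ph_rxi_self, ph_zero] at h
  rw [eq_comm, ← sub_eq_zero, ← h]
  module

/-- The Reeb vector fields are Killing. -/
theorem der_rxi_gm (α : Fin 3) (X Y : V) :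
    der F V (rxi F V α) (gm F V X Y)
      = gm F V (lie F V (rxi F V α) X) Y + gm F V X (lie F V (rxi F V α) Y) := by
  have key : ∀ X Y : V, der F V (rxi F V α) (gm F V X (ph F V α Y))
      = gm F V (lie F V (rxi F V α) X) (ph F V α Y)
        + gm F V X (lie F V (rxi F V α) (ph F V α Y)) := by
    intro X Y
    have h := lieDeriv_eq_zero (Phi_isTwoForm α) (ThreeQS.qs (F := F) α).2
      (Z := rxi F V α) (fun X => by rw [Phi_rxi_left, et_ph_self]) X Y
    simp only [lieDeriv, Phi] at h
    rw [lie_rxi_ph_self]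
    linear_combination h
  have hY : Y = -ph F V α (ph F V α Y) + et F V α Y • rxi F V α := by rw [ph_ph]; abel
  generalize hf : et F V α Y = f at hY
  generalize ph F V α Y = Z at hY
  subst hY
  have hX := et_lie_rxi_self (F := F) α X
  rw [lie_add_right, lie_neg_right, lie_smul_right, lie_self]
  simp only [(gm_right X).add, (gm_right X).neg, (gm_right X).smul, (gm_right _).add,
    (gm_right _).neg, (gm_right _).smul, ← et_eq, der_add, der_neg, der_mul, key, hX,
    (gm_right X).zero]
  ring

theorem lie_rxi_rxi (α β : Fin 3) :
    lie F V (rxi F V α) (rxi F V β) = algebraMap ℝ F (cc F V) • ph F V α (rxi F V β) := by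
  obtain rfl | ⟨c, h⟩ | ⟨c, h⟩ := eq_or_cyclic α β
  · rw [lie_self, ph_rxi_self, smul_zero]
  · rw [h.ph_rxi]
    exact ThreeQS.reeb_bracket _ _ _ h
  · rw [h.ph_rxi_neg, lie_anti, smul_neg, neg_inj]
    exact ThreeQS.reeb_bracket _ _ _ h

/-- `L_{ξ_α} η_β = c g(·, φ_α ξ_β)`. -/
theorem der_rxi_et_sub (α β : Fin 3) (X : V) :
    der F V (rxi F V α) (et F V β X) - et F V β (lie F V (rxi F V α) X)
      = algebraMap ℝ F (cc F V) * gm F V X (ph F V α (rxi F V β)) := by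
  rw [et_eq, et_eq, der_rxi_gm, lie_rxi_rxi, (gm_right X).smul]
  ring

/-- `dη_α` and `(c/2) Φ_α` agree as soon as one argument is vertical. -/
theorem two_mul_dEt_rxi (α β : Fin 3) (X : V) :
    2 * dOne F V (et F V α) X (rxi F V β)
      = algebraMap ℝ F (cc F V) * Phi F V α X (rxi F V β) := by
  have h1 : der F V X (et F V α (rxi F V β)) = 0 := by
    obtain rfl | h := eq_or_ne α β
    · rw [et_rxi, der_one]
    · rw [et_rxi_of_ne h, der_zero]
  have h2 := congrArg (gm F V X) (lie_anti (F := F) (rxi F V α) (rxi F V β))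
  rw [lie_rxi_rxi, lie_rxi_rxi, (gm_right X).smul, (gm_right X).neg, (gm_right X).smul] at h2
  rw [two_mul_dOne, h1, lie_anti, (et_isOneForm α).neg, Phi]
  linear_combination -der_rxi_et_sub (F := F) β α X - h2

theorem dEt_horiz_rxi {X : V} (hX : Horiz F V X) (α β : Fin 3) :
    dOne F V (et F V α) X (rxi F V β) = 0 := by
  apply two_mul_cancel
  rw [two_mul_dEt_rxi, Phi, gm_horiz_ph_rxi hX, mul_zero, mul_zero]

theorem horiz_lie_rxi {X : V} (hX : Horiz F V X) (α : Fin 3) :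
    Horiz F V (lie F V (rxi F V α) X) := by
  intro β
  have h := der_rxi_et_sub (F := F) α β X
  rw [hX, der_zero, gm_horiz_ph_rxi hX] at h
  linear_combination -h

theorem horiz_etaEndo {X : V} (hX : Horiz F V X) (α : Fin 3) :
    Horiz F V (etaEndo F V α X) := by
  intro β
  rw [et_eq, gm_etaEndo_left, gm_etaEndo, dEt_horiz_rxi hX, neg_zero]

theorem gm_lie_rxi_ph (α β : Fin 3) (Z Y : V) :
    gm F V Z (lie F V (rxi F V α) (ph F V β Y) - ph F V β (lie F V (rxi F V α) Y))
      = 2 * dOne F V (Phi F V β (rxi F V α)) Z Y := by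
  rw [← lieDeriv_eq_dOne (Phi_isTwoForm β) (ThreeQS.qs (F := F) β).2, lieDeriv, Phi, Phi, Phi,
    der_rxi_gm, (gm_right Z).sub]
  ring

/-- `L_{ξ_a} φ_b = 2 A_c`. -/
theorem Cyclic.lie_rxi_ph {a b c : Fin 3} (h : Cyclic a b c) (Y : V) :
    lie F V (rxi F V a) (ph F V b Y)
      = ph F V b (lie F V (rxi F V a) Y) + (2 : F) • etaEndo F V c Y := by
  rw [← sub_eq_iff_eq_add']
  refine eq_of_gm (F := F) fun Z => ?_
  rw [gm_lie_rxi_ph, (gm_right Z).smul, gm_etaEndo]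
  congr 2
  funext U
  rw [Phi_rxi_left, h.et_ph]

/-- `L_{ξ_b} φ_a = -2 A_c`. -/
theorem Cyclic.lie_rxi_ph_neg {a b c : Fin 3} (h : Cyclic a b c) (Y : V) :
    lie F V (rxi F V b) (ph F V a Y)
      = ph F V a (lie F V (rxi F V b) Y) - (2 : F) • etaEndo F V c Y := by
  rw [sub_eq_add_neg, ← sub_eq_iff_eq_add']
  refine eq_of_gm (F := F) fun Z => ?_
  rw [gm_lie_rxi_ph, (gm_right Z).neg, (gm_right Z).smul, gm_etaEndo, two_mul_dOne, two_mul_dOne]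
  simp only [Phi_rxi_left, h.et_ph_neg, der_neg]
  ring

theorem Cyclic.etaEndo_eq_neg_ph {a b c : Fin 3} (h : Cyclic a b c) {Y : V}
    (hY : Horiz F V Y) : etaEndo F V b Y = -ph F V a (etaEndo F V c Y) := by
  have h1 := h.rotate.rotate.lie_rxi_ph_neg (F := F) Y
  rw [h.ph_eq_of_horiz hY, h.ph_eq_of_horiz (horiz_lie_rxi hY _), lie_rxi_ph_self,
    h.lie_rxi_ph, ph_add, ph_smul] at h1
  apply two_smul_cancel (F := F)
  rw [eq_sub_iff_add_eq, add_assoc, add_eq_left] at h1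
  rw [smul_neg, eq_neg_iff_add_eq_zero, add_comm, h1]

theorem Cyclic.etaEndo_eq_ph {a b c : Fin 3} (h : Cyclic a b c) {Y : V}
    (hY : Horiz F V Y) : etaEndo F V a Y = ph F V b (etaEndo F V c Y) := by
  have h1 := h.rotate.lie_rxi_ph (F := F) Y
  rw [h.ph_eq_neg_of_horiz hY, h.ph_eq_neg_of_horiz (horiz_lie_rxi hY _), lie_neg_right,
    lie_rxi_ph_self, h.lie_rxi_ph_neg, ph_sub, ph_smul, neg_sub, sub_eq_add_neg, add_comm,
    add_right_inj] at h1
  exact (two_smul_cancel h1).symm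

theorem lie_rxi_etaEndo {α β γ : Fin 3} {r : ℝ}
    (h : ∀ U, der F V (rxi F V β) (et F V α U) - et F V α (lie F V (rxi F V β) U)
      = algebraMap ℝ F r * et F V γ U) (Y : V) :
    lie F V (rxi F V β) (etaEndo F V α Y)
      = etaEndo F V α (lie F V (rxi F V β) Y) + algebraMap ℝ F r • etaEndo F V γ Y := by
  refine eq_of_gm (F := F) fun Z => ?_
  have h1 := der_rxi_gm (F := F) β Z (etaEndo F V α Y)
  have h2 := lieDeriv_dOne (F := F) _ (et_isOneForm α) (rxi F V β) Z Y
  simp only [lieDeriv, h] at h2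
  rw [gm_etaEndo, gm_etaEndo] at h1
  rw [(gm_right Z).add, (gm_right Z).smul, gm_etaEndo, gm_etaEndo]
  have h3 : dOne F V (fun U => algebraMap ℝ F r * et F V γ U) Z Y
      = algebraMap ℝ F r * dOne F V (et F V γ) Z Y := by
    apply two_mul_cancel
    rw [mul_left_comm, two_mul_dOne, two_mul_dOne, der_algebraMap_mul, der_algebraMap_mul]
    ring
  linear_combination h2 - h1 + h3

theorem two_smul_etaEndo_sq {c : Fin 3} {Y : V} (hY : Horiz F V Y) :
    (2 : F) • etaEndo F V c (etaEndo F V c Y)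
      = algebraMap ℝ F (cc F V) • ph F V c (etaEndo F V c Y) := by
  obtain ⟨a, b, h⟩ := exists_cyclic c
  have h1 := congrArg (lie F V (rxi F V b)) (h.etaEndo_eq_neg_ph (F := F) hY)
  rw [lie_rxi_etaEndo (r := 0) (γ := b), lie_neg_right, h.lie_rxi_ph_neg,
    lie_rxi_etaEndo (r := cc F V) (γ := a), h.etaEndo_eq_neg_ph (horiz_lie_rxi hY _), map_zero,
    zero_smul, ph_add, ph_smul, h.etaEndo_eq_ph hY] at h1
  · have h2 := h.ph_eq (F := F) (etaEndo F V c Y)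
    rw [horiz_etaEndo hY, zero_smul, sub_zero] at h2
    rw [h2, eq_comm, ← sub_eq_zero, ← sub_eq_zero.2 h1]
    abel
  · intro U
    rw [der_rxi_et_sub, h.rotate.ph_rxi, et_eq]
  · intro U
    rw [et_lie_rxi_self, sub_self, map_zero, zero_mul]

theorem cc_mul_cancel (hc : cc F V ≠ 0) {x y : F}
    (h : algebraMap ℝ F (cc F V) * x = algebraMap ℝ F (cc F V) * y) : x = y := by
  have h1 : algebraMap ℝ F (cc F V)⁻¹ * algebraMap ℝ F (cc F V) = 1 := by
    rw [← map_mul, inv_mul_cancel₀ hc, map_one]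
  linear_combination (y - x) * h1 + algebraMap ℝ F (cc F V)⁻¹ * h

theorem etaEndo_ph (hc : cc F V ≠ 0) (c : Fin 3) {Y : V} (hY : Horiz F V Y) :
    etaEndo F V c (ph F V c Y) = ph F V c (etaEndo F V c Y) := by
  refine eq_of_gm_horiz (horiz_etaEndo (horiz_ph hY c) c) (horiz_ph (horiz_etaEndo hY c) c)
    fun Z hZ => ?_
  apply cc_mul_cancel hc
  have h1 := congrArg (gm F V Z) (two_smul_etaEndo_sq (F := F) (c := c) hY)
  have h2 := congrArg (fun X => gm F V X Y) (two_smul_etaEndo_sq (F := F) (c := c) hZ)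
  simp only [(gm_left Y).smul, (gm_right Z).smul, gm_etaEndo_left, gm_ph_left] at h1 h2
  linear_combination h1 - h2

/-- `dη_α = (c/2) Φ_α` on `E^{4l}`, in terms of endomorphisms. -/
theorem two_smul_etaEndo_of_E4l (hc : cc F V ≠ 0) (c : Fin 3) {Y : V} (hY : InE4l F V Y) :
    (2 : F) • etaEndo F V c Y = algebraMap ℝ F (cc F V) • ph F V c Y := by
  obtain ⟨a, b, h⟩ := exists_cyclic c
  set U := (2 : F) • etaEndo F V c Y - algebraMap ℝ F (cc F V) • ph F V c Y with hU
  have hUH : Horiz F V U := by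
    intro β
    rw [hU, (et_isOneForm β).sub, (et_isOneForm β).smul, (et_isOneForm β).smul,
      horiz_etaEndo hY.1, horiz_ph hY.1, mul_zero, mul_zero, sub_zero]
  have hc0 : etaEndo F V c U = 0 := by
    rw [hU, sub_eq_add_neg, ← neg_smul, etaEndo_add, etaEndo_smul, etaEndo_smul,
      etaEndo_ph hc c hY.1, two_smul_etaEndo_sq hY.1]
    module
  have h0 : ∀ α, etaEndo F V α U = 0 := by
    intro α
    obtain rfl | rfl | rfl := h.eq_or_eq_or_eq α
    · rw [h.etaEndo_eq_ph hUH, hc0, ph_zero]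
    · rw [h.etaEndo_eq_neg_ph hUH, hc0, ph_zero, neg_zero]
    · exact hc0
  have hUE : InE4m F V U := by
    refine ⟨hUH, fun α X => ?_⟩
    rw [(dEt_isTwoForm α).anti, ← gm_etaEndo, h0, (gm_right X).zero, neg_zero]
  refine sub_eq_zero.1 (eq_of_gm_horiz hUH (fun β => (et_isOneForm β).zero) fun Z hZ => ?_)
  obtain ⟨Z₁, Z₂, hZ₁, hZ₂, rfl⟩ := ThreeQS.horiz_split (F := F) Z hZ
  rw [(gm_left _).add, hZ₁.2 U hUE, zero_add, (gm_right (Z₁ + Z₂)).zero, (gm_right Z₂).sub,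
    (gm_right Z₂).smul, (gm_right Z₂).smul, gm_etaEndo, hZ₂.2, gm_symm,
    (ThreeQS.phi_E4l c Y hY).2 Z₂ hZ₂]
  ring

end Reeb

section Foliation

variable {F V : Type} [CommRing F] [Algebra ℝ F] [AddCommGroup V] [Module F V]
  [SmoothSetting F V] [ACM3 F V] [ThreeQS F V]

/-- The 2-form `c Φ_α - 2 dη_α`, which is supported on `E^{4m}`. -/
def leafForm (F V : Type) [CommRing F] [Algebra ℝ F] [AddCommGroup V] [Module F V]
    [SmoothSetting F V] [ACM3 F V] [ThreeQS F V] (α : Fin 3) (X Y : V) : F :=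
  algebraMap ℝ F (cc F V) * Phi F V α X Y - 2 * dOne F V (et F V α) X Y

theorem leafForm_isTwoForm (α : Fin 3) : IsTwoForm (leafForm F V α) where
  anti X Y := by
    rw [leafForm, leafForm, (Phi_isTwoForm α).anti, (dEt_isTwoForm α).anti]; ring
  left Z :=
    { add := fun X Y => by
        simp only [leafForm, ((Phi_isTwoForm α).left Z).add, ((dEt_isTwoForm α).left Z).add]
        ring
      smul := fun f X => by
        simp only [leafForm, ((Phi_isTwoForm α).left Z).smul, ((dEt_isTwoForm α).left Z).smul]
        ring }

theorem leafForm_isClosedTwo (α : Fin 3) : IsClosedTwo F V (leafForm F V α) := by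
  intro X Y Z
  have h1 := (dTwo_eq_zero_iff (Phi F V α) X Y Z).1 ((ThreeQS.qs (F := F) α).2 X Y Z)
  have h2 := (dTwo_eq_zero_iff _ X Y Z).1 (dEt_isClosedTwo (F := F) α X Y Z)
  rw [dTwo_eq_zero_iff]
  simp only [leafForm, der_sub, der_algebraMap_mul, der_two_mul]
  linear_combination algebraMap ℝ F (cc F V) * h1 - 2 * h2

theorem leafForm_rxi (α β : Fin 3) (X : V) : leafForm F V α X (rxi F V β) = 0 := by
  rw [leafForm, two_mul_dEt_rxi, sub_self]

theorem leafForm_inVert (α : Fin 3) (X : V) {Y : V} (hY : InVert F V Y) :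
    leafForm F V α X Y = 0 := by
  obtain ⟨p, q, r, rfl⟩ := hY
  have h := (leafForm_isTwoForm (F := F) α).right X
  simp only [h.add, h.smul, leafForm_rxi, mul_zero, add_zero]

theorem exists_E4l3_add_E4m (X : V) :
    ∃ Y Z, InE4l3 F V Y ∧ InE4m F V Z ∧ X = Y + Z := by
  obtain ⟨Y, Z, hY, hZ, h⟩ := ThreeQS.horiz_split (F := F) _ (horiz_sub_sum (F := F) X)
  refine ⟨_, Z, ⟨Y, _, hY, inVert_sum X, rfl⟩, hZ, ?_⟩
  rw [sub_eq_iff_eq_add] at h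
  nth_rewrite 1 [h]
  abel

theorem inE4l3_of_orth {X : V} (h : ∀ W, InE4m F V W → gm F V W X = 0) : InE4l3 F V X := by
  obtain ⟨Y, Z, hY, hZ, rfl⟩ := exists_E4l3_add_E4m (F := F) X
  have hZ0 : Z = 0 := by
    refine eq_of_gm (F := F) fun U => ?_
    obtain ⟨U₁, U₂, hU₁, hU₂, rfl⟩ := exists_E4l3_add_E4m (F := F) U
    have h1 := h U₂ hU₂
    rw [(gm_right U₂).add, gm_symm U₂ Y, gm_E4l3_E4m hY hU₂, zero_add] at h1
    rw [(gm_left Z).add, gm_E4l3_E4m hU₁ hZ, h1, (gm_right _).zero, add_zero]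
  rwa [hZ0, add_zero]

theorem inE4m_of_orth {X : V} (h : ∀ W, InE4l3 F V W → gm F V W X = 0) : InE4m F V X := by
  obtain ⟨Y, Z, hY, hZ, rfl⟩ := exists_E4l3_add_E4m (F := F) X
  have hY0 : Y = 0 := by
    refine eq_of_gm (F := F) fun U => ?_
    obtain ⟨U₁, U₂, hU₁, hU₂, rfl⟩ := exists_E4l3_add_E4m (F := F) U
    have h1 := h U₁ hU₁
    rw [(gm_right U₁).add, gm_E4l3_E4m hU₁ hZ, add_zero] at h1
    rw [(gm_left Y).add, gm_symm U₂ Y, gm_E4l3_E4m hY hU₂, h1, (gm_right _).zero, add_zero]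
  rwa [hY0, zero_add]

theorem inE4l3_rxi (α : Fin 3) : InE4l3 F V (rxi F V α) := by
  refine inE4l3_of_orth fun W hW => ?_
  rw [← et_eq, hW.1]

theorem inE4l3_ph (α : Fin 3) {X : V} (hX : InE4l3 F V X) : InE4l3 F V (ph F V α X) := by
  refine inE4l3_of_orth fun W hW => ?_
  rw [gm_symm, gm_ph_left, gm_E4l3_E4m hX (ThreeQS.phi_E4m α W hW), neg_zero]

theorem inE4m_ph (α : Fin 3) {X : V} (hX : InE4m F V X) : InE4m F V (ph F V α X) :=
  ThreeQS.phi_E4m α X hX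

theorem leafForm_E4m_right (α : Fin 3) (X : V) {W : V} (hW : InE4m F V W) :
    leafForm F V α X W = algebraMap ℝ F (cc F V) * gm F V X (ph F V α W) := by
  rw [leafForm, dEt_E4m_right α X hW, Phi, mul_zero, sub_zero]

theorem leafForm_E4m_left (α : Fin 3) {W : V} (hW : InE4m F V W) (X : V) :
    leafForm F V α W X = algebraMap ℝ F (cc F V) * gm F V W (ph F V α X) := by
  rw [leafForm, hW.2, Phi, mul_zero, sub_zero]

/-- `c Φ_α - 2 dη_α` vanishes on `E^{4l+3}`. -/
theorem leafForm_E4l3 (hc : cc F V ≠ 0) (α : Fin 3) {X : V} (hX : InE4l3 F V X) (Y : V) :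
    leafForm F V α X Y = 0 := by
  obtain ⟨Y₁, W, ⟨Yl, Yv, hYl, hYv, rfl⟩, hW, rfl⟩ := exists_E4l3_add_E4m (F := F) Y
  have h := (leafForm_isTwoForm (F := F) α).right X
  rw [h.add, h.add, leafForm_inVert α X hYv, leafForm_E4m_right α X hW,
    gm_E4l3_E4m hX (inE4m_ph α hW)]
  obtain ⟨Xl, Xv, hXl, hXv, rfl⟩ := hX
  have h1 := congrArg (gm F V Xl) (two_smul_etaEndo_of_E4l hc α hYl)
  rw [(gm_right Xl).smul, (gm_right Xl).smul, gm_etaEndo] at h1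
  rw [((leafForm_isTwoForm α).left Yl).add, (leafForm_isTwoForm α).anti Xv,
    leafForm_inVert α Yl hXv, leafForm, Phi]
  linear_combination -h1

theorem two_mul_dEt_E4l3 (hc : cc F V ≠ 0) (α : Fin 3) {X : V} (hX : InE4l3 F V X) (Y : V) :
    2 * dOne F V (et F V α) X Y = algebraMap ℝ F (cc F V) * gm F V X (ph F V α Y) :=
  (sub_eq_zero.1 (leafForm_E4l3 hc α hX Y)).symm

theorem leafForm_lie_E4l3 (hc : cc F V ≠ 0) {Z : V} (hZ : InE4l3 F V Z) (α : Fin 3) (X Y : V) :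
    der F V Z (leafForm F V α X Y)
      = leafForm F V α (lie F V Z X) Y + leafForm F V α X (lie F V Z Y) := by
  have h := lieDeriv_eq_zero (leafForm_isTwoForm (F := F) α) (leafForm_isClosedTwo α)
    (leafForm_E4l3 hc α hZ) X Y
  rw [lieDeriv] at h
  linear_combination h

theorem Cyclic.two_mul_dEt_ph (hc : cc F V ≠ 0) {a b c : Fin 3} (h : Cyclic a b c) (X Y : V) :
    2 * dOne F V (et F V a) X (ph F V c Y) = -(2 * dOne F V (et F V b) X Y)
      + algebraMap ℝ F (cc F V) * (et F V a X * et F V c Y) := by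
  obtain ⟨X, W, hX, hW, rfl⟩ := exists_E4l3_add_E4m (F := F) X
  rw [((dEt_isTwoForm (F := F) a).left _).add, ((dEt_isTwoForm b).left _).add, hW.2, hW.2, add_zero,
    add_zero, two_mul_dEt_E4l3 hc a hX, two_mul_dEt_E4l3 hc b hX, (et_isOneForm a).add, hW.1,
    add_zero]
  have h1 := h.Phi_ph (F := F) X Y
  rw [Phi, Phi] at h1
  linear_combination algebraMap ℝ F (cc F V) * h1

theorem Cyclic.leafForm_ph (hc : cc F V ≠ 0) {a b c : Fin 3} (h : Cyclic a b c) (X Y : V) :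
    leafForm F V a X (ph F V c Y) = -leafForm F V b X Y := by
  rw [leafForm, leafForm, h.two_mul_dEt_ph hc, h.Phi_ph]
  ring

/-- `φ_γ` is projectable along `E^{4m}`. -/
theorem gm_lie_ph_of_E4m (hc : cc F V ≠ 0) {W : V} (hW : InE4m F V W) (γ : Fin 3) {X : V}
    (hX : InE4l3 F V X) (Y : V) :
    gm F V X (lie F V W (ph F V γ Y)) = gm F V X (ph F V γ (lie F V W Y)) := by
  obtain ⟨a, b, h⟩ := exists_cyclic γ
  have key : ∀ X, InE4l3 F V X → gm F V X (ph F V a (lie F V W (ph F V γ Y)))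
      = gm F V X (ph F V a (ph F V γ (lie F V W Y))) := by
    intro X hX
    apply cc_mul_cancel hc
    rw [← two_mul_dEt_E4l3 hc a hX, ← two_mul_dEt_E4l3 hc a hX, h.two_mul_dEt_ph hc]
    have h1 := dEt_lie_E4m hW a X (ph F V γ Y)
    have h2 := dEt_lie_E4m hW b X Y
    have h3 := congrArg (der F V W) (h.two_mul_dEt_ph hc X Y)
    rw [der_add, der_neg, der_two_mul, der_two_mul, der_algebraMap_mul, der_mul] at h3
    have h4 := h.two_mul_dEt_ph hc (lie F V W X) Y
    rw [et_lie_E4m hW] at h4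
    rw [et_lie_E4m hW]
    linear_combination -2 * h1 - 2 * h2 + h3 - h4
  have h1 := key _ (inE4l3_ph a hX)
  rw [gm_ph_ph, gm_ph_ph, et_lie_E4m hW, h.rotate.rotate.et_ph_neg, h.rotate.rotate.et_ph_neg,
    et_lie_E4m hW, der_neg] at h1
  linear_combination h1

/-- `φ_γ` is projectable along `E^{4l+3}`. -/
theorem gm_lie_ph_of_E4l3 (hc : cc F V ≠ 0) {Z : V} (hZ : InE4l3 F V Z) (γ : Fin 3) {X : V}
    (hX : InE4m F V X) (Y : V) :
    gm F V X (lie F V Z (ph F V γ Y)) = gm F V X (ph F V γ (lie F V Z Y)) := by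
  obtain ⟨a, b, h⟩ := exists_cyclic γ
  have key : ∀ X, InE4m F V X → gm F V X (ph F V a (lie F V Z (ph F V γ Y)))
      = gm F V X (ph F V a (ph F V γ (lie F V Z Y))) := by
    intro X hX
    apply cc_mul_cancel hc
    rw [← leafForm_E4m_left a hX, ← leafForm_E4m_left a hX, h.leafForm_ph hc]
    have h1 := leafForm_lie_E4l3 hc hZ a X (ph F V γ Y)
    have h2 := leafForm_lie_E4l3 hc hZ b X Y
    rw [h.leafForm_ph hc, h.leafForm_ph hc, der_neg] at h1
    linear_combination -h1 - h2
  have h1 := key _ (inE4m_ph a hX)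
  rw [gm_ph_ph, gm_ph_ph, hX.1] at h1
  linear_combination h1

/-- The foliation defined by `E^{4m}` is Riemannian. -/
theorem der_gm_of_E4m (hc : cc F V ≠ 0) {W X Y : V} (hW : InE4m F V W) (hX : InE4l3 F V X)
    (hY : InE4l3 F V Y) :
    der F V W (gm F V X Y) = gm F V (lie F V W X) Y + gm F V X (lie F V W Y) := by
  apply cc_mul_cancel hc
  have h := congrArg (2 * ·) (dEt_lie_E4m hW 0 X (ph F V 0 Y))
  have h1 := gm_lie_ph_of_E4m hc hW 0 (inE4l3_ph 0 hX) Y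
  simp only [mul_add] at h
  rw [← der_two_mul, two_mul_dEt_E4l3 hc 0 hX, two_mul_dEt_E4l3 hc 0 hX, der_algebraMap_mul,
    (dEt_isTwoForm 0).anti (lie F V W X), mul_neg, two_mul_dEt_E4l3 hc 0 (inE4l3_ph 0 hY),
    gm_ph_right 0 X (ph F V 0 Y),
    gm_ph_right 0 X (lie F V W (ph F V 0 Y)), h1, gm_ph_ph, gm_ph_ph,
    gm_ph_ph, et_lie_E4m hW, et_lie_E4m hW, der_neg, der_sub, der_mul, gm_symm Y] at h
  linear_combination -h

/-- The foliation defined by `E^{4l+3}` is Riemannian. -/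
theorem der_gm_of_E4l3 (hc : cc F V ≠ 0) {Z X Y : V} (hZ : InE4l3 F V Z) (hX : InE4m F V X)
    (hY : InE4m F V Y) :
    der F V Z (gm F V X Y) = gm F V (lie F V Z X) Y + gm F V X (lie F V Z Y) := by
  apply cc_mul_cancel hc
  have h := leafForm_lie_E4l3 hc hZ 0 X (ph F V 0 Y)
  have h1 := gm_lie_ph_of_E4l3 hc hZ 0 (inE4m_ph 0 hX) Y
  rw [leafForm_E4m_left 0 hX, leafForm_E4m_left 0 hX, der_algebraMap_mul,
    (leafForm_isTwoForm 0).anti (lie F V Z X), leafForm_E4m_left 0 (inE4m_ph 0 hY),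
    gm_ph_right 0 X (ph F V 0 Y),
    gm_ph_right 0 X (lie F V Z (ph F V 0 Y)), h1, gm_ph_ph, gm_ph_ph,
    gm_ph_ph, hX.1, hY.1, zero_mul, zero_mul, zero_mul, der_neg, sub_zero, sub_zero, sub_zero,
    gm_symm Y] at h
  linear_combination -h

theorem inE4m_lie_rxi (hc : cc F V ≠ 0) {W : V} (hW : InE4m F V W) (α : Fin 3) :
    InE4m F V (lie F V W (rxi F V α)) := by
  refine inE4m_of_orth fun X hX => ?_
  have h := der_gm_of_E4m hc hW hX (inE4l3_rxi α)
  rw [← et_eq, ← et_eq, et_lie_E4m hW] at h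
  linear_combination -h

theorem basicE4m_ph (hc : cc F V ≠ 0) (α : Fin 3) {X : V} (hX : BasicE4m F V X) :
    BasicE4m F V (ph F V α X) := by
  refine ⟨inE4l3_ph α hX.1, fun W hW => inE4m_of_orth fun Y hY => ?_⟩
  rw [gm_lie_ph_of_E4m hc hW α hY, gm_E4l3_E4m hY (inE4m_ph α (hX.2 W hW))]

theorem dEt_eq_of_E4l3 (hc : cc F V ≠ 0) (α : Fin 3) {X : V} (hX : InE4l3 F V X) (Y : V) :
    dOne F V (et F V α) X Y = algebraMap ℝ F (cc F V / 2) * Phi F V α X Y := by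
  apply two_mul_cancel
  have h2 : 2 * algebraMap ℝ F (cc F V / 2) = algebraMap ℝ F (cc F V) := by
    rw [← map_ofNat (algebraMap ℝ F) 2, ← map_mul, mul_div_cancel₀ _ two_ne_zero]
  rw [two_mul_dEt_E4l3 hc α hX, ← mul_assoc, h2, Phi]

section Leaves

variable [LeviCivita F V]

/-- The leaves of `E^{4m}` are totally geodesic. -/
theorem inE4m_nab (hc : cc F V ≠ 0) {X Y : V} (hX : InE4m F V X) (hY : InE4m F V Y) :
    InE4m F V (nab F V X Y) := by
  refine inE4m_of_orth fun Z hZ => ?_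
  have h1 := der_gm_of_E4l3 hc hZ hX hY
  have h2 := der_gm_nab (F := F) X Z Y
  have h3 := der_gm_nab (F := F) Y Z X
  have h4 := gm_E4l3_E4m hZ (inE4m_lie hX hY)
  rw [gm_E4l3_E4m hZ hY, der_zero] at h2
  rw [gm_E4l3_E4m hZ hX, der_zero] at h3
  rw [der_gm_nab, lie_eq_nab, lie_eq_nab, (gm_left Y).sub, (gm_right X).sub,
    gm_symm X (nab F V Y Z)] at h1
  rw [lie_eq_nab, (gm_right Z).sub] at h4
  apply two_mul_cancel
  linear_combination -h1 - h2 - h3 + h4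

/-- The structures induced on the leaves of `E^{4m}` are Kähler. -/
theorem nabPh_eq_zero (α : Fin 3) {X Y Z : V} (hX : InE4m F V X) (hY : InE4m F V Y)
    (hZ : InE4m F V Z) : nabPh F V α X Y Z = 0 := by
  obtain ⟨hN, hC⟩ := ThreeQS.qs (F := F) (V := V) α
  have h1 := nabPh_cyclic hC X Y Z
  have h2 := nabPh_cyclic hC X (ph F V α Y) (ph F V α Z)
  have h3 := nabPh_of_isNormal hN (hY.2 α Z) ((inE4m_ph α hX).1 α)
  have hJ : ∀ {U : V}, InE4m F V U → ph F V α (ph F V α U) = -U := fun {U} hU => by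
    rw [ph_ph, hU.1, zero_smul, add_zero]
  rw [hJ hX, nabPh_neg_right, nabPh_neg_right, nabPh_anti α Z Y X] at h3
  rw [nabPh_ph_middle α X (hY.1 α) (et_ph_self α Z), hJ hZ, nabPh_neg_right,
    nabPh_ph_middle α _ (hZ.1 α) (hX.1 α), nabPh_anti α _ X,
    nabPh_ph_middle α _ (hY.1 α) (hX.1 α)] at h2
  apply two_mul_cancel
  linear_combination h1 - h2 + h3

theorem nab_ph_of_E4m (hc : cc F V ≠ 0) (α : Fin 3) {X Y : V} (hX : InE4m F V X)
    (hY : InE4m F V Y) : nab F V X (ph F V α Y) = ph F V α (nab F V X Y) := by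
  refine eq_of_gm (F := F) fun Z => ?_
  obtain ⟨Z₁, Z₂, hZ₁, hZ₂, rfl⟩ := exists_E4l3_add_E4m (F := F) Z
  rw [(gm_left _).add, (gm_left _).add, gm_E4l3_E4m hZ₁ (inE4m_nab hc hX (inE4m_ph α hY)),
    gm_E4l3_E4m hZ₁ (inE4m_ph α (inE4m_nab hc hX hY)), zero_add, zero_add]
  exact sub_eq_zero.1 (nabPh_eq_zero α hX hY hZ₂)

end Leaves

end Foliation

/-- In a 3-quasi-Sasakian manifold of rank `4l+3` the integrable
distribution `E^{4m}` defines a Riemannian foliation whose leaves (with the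
induced structures) are hyper-Kähler; the `η_α`, `dη_α`, `ξ_α`, `φ_α` and `g`
are projectable with respect to it, and the leaf space carries an induced
3-α-Sasakian structure (`α = c/2`). -/
theorem e4m_foliation (F V : Type) [CommRing F] [Algebra ℝ F] [AddCommGroup V] [Module F V]
    [SmoothSetting F V] [ACM3 F V] [ThreeQS F V] [LeviCivita F V]
    (l : ℕ) [HasRank F V l] :
    (∀ X Y : V, InE4m F V X → InE4m F V Y → InE4m F V (lie F V X Y)) ∧
    (∀ W X Y : V, InE4m F V W → InE4l3 F V X → InE4l3 F V Y →
      der F V W (gm F V X Y)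
        = gm F V (lie F V W X) Y + gm F V X (lie F V W Y)) ∧
    (∀ X Y : V, InE4m F V X → InE4m F V Y → InE4m F V (nab F V X Y)) ∧
    (∀ (α : Fin 3) (X Y : V), InE4m F V X → InE4m F V Y →
      nab F V X (ph F V α Y) = ph F V α (nab F V X Y)) ∧
    (∀ a b c' : Fin 3, Cyclic a b c' → ∀ X : V, InE4m F V X →
      ph F V c' X = ph F V a (ph F V b X)) ∧
    (∀ (α : Fin 3) (W : V), InE4m F V W →
      et F V α W = 0 ∧ ∀ X : V, dOne F V (et F V α) W X = 0) ∧
    (∀ (α : Fin 3) (W : V), InE4m F V W → InE4m F V (lie F V W (rxi F V α))) ∧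
    (∀ (α : Fin 3) (X : V), BasicE4m F V X → BasicE4m F V (ph F V α X)) ∧
    (cc F V / 2 ≠ 0 ∧
      ∀ (α : Fin 3) (X Y : V), InE4l3 F V X → InE4l3 F V Y →
        dOne F V (et F V α) X Y = algebraMap ℝ F (cc F V / 2) * Phi F V α X Y) := by
  have hc : cc F V ≠ 0 := HasRank.c_ne l
  exact ⟨fun X Y hX hY => inE4m_lie hX hY,
    fun W X Y hW hX hY => der_gm_of_E4m hc hW hX hY,
    fun X Y hX hY => inE4m_nab hc hX hY,
    fun α X Y hX hY => nab_ph_of_E4m hc α hX hY,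
    fun a b c' h X hX => h.ph_eq_of_horiz hX.1,
    fun α W hW => ⟨hW.1 α, hW.2 α⟩,
    fun α W hW => inE4m_lie_rxi hc hW α,
    fun α X hX => basicE4m_ph hc α hX,
    div_ne_zero hc two_ne_zero,
    fun α X Y hX _ => dEt_eq_of_E4l3 hc α hX Y⟩

end QS3
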